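/- arXiv:1710.00086 — 3 statements merged into one kernel-verified Lean document; each statement's English description precedes it below -/
import Mathlib

section
/- There are no diregular (2,k,+3)-digraphs for k ≥ 4; that is, for every k ≥ 4 there is no diregular k-geodetic digraph of degree 2 on M(2,k) + 3 vertices. -/
/-- `p` is a directed walk from `u` to `v` in the digraph with arc relation `A`,
recorded as the list of its vertices; a walk of length `l` (i.e. with `l` arcs)
is a list of `l + 1` vertices. -/
def IsWalkFrom {V : Type*} (A : V → V → Prop) (u v : V) (p : List V) : Prop :=
  p.Chain' A ∧ p.head? = some u ∧ p.getLast? = some v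

/-- A digraph is `k`-geodetic if for every ordered pair of vertices `(u, v)`
there is at most one directed path of length at most `k` from `u` to `v`. -/
def IsKGeodetic {V : Type*} (A : V → V → Prop) (k : ℕ) : Prop :=
  ∀ (u v : V) (p q : List V), IsWalkFrom A u v p → IsWalkFrom A u v q →
    p.length ≤ k + 1 → q.length ≤ k + 1 → p = q

/-- `Nout A u = N⁺(u)`, the set of out-neighbours of `u`. -/
def Nout {V : Type*} (A : V → V → Prop) (u : V) : Set V := {v | A u v}

/-- `Nin A u = N⁻(u)`, the set of in-neighbours of `u`. -/
def Nin {V : Type*} (A : V → V → Prop) (u : V) : Set V := {v | A v u}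

/-- `NIter A l u = N^l(u)`, the set of vertices reachable from `u` by a
directed path of length exactly `l`. -/
def NIter {V : Type*} (A : V → V → Prop) (l : ℕ) (u : V) : Set V :=
  {v | ∃ p : List V, IsWalkFrom A u v p ∧ p.length = l + 1}

/-- `Ball A l u = T_l(u) = N^0(u) ∪ N^1(u) ∪ ⋯ ∪ N^l(u)`, the set of vertices
at distance at most `l` from `u`. -/
def Ball {V : Type*} (A : V → V → Prop) (l : ℕ) (u : V) : Set V :=
  {v | ∃ m ≤ l, v ∈ NIter A m u}

/-- `Outliers A k u = O(u) = {v | d(u,v) ≥ k + 1}`, the outlier set of `u`. -/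
def Outliers {V : Type*} (A : V → V → Prop) (k : ℕ) (u : V) : Set V :=
  {v | v ∉ Ball A k u}

/-- A digraph is diregular with degree `d` if every vertex has out-degree `d`
and in-degree `d`. -/
def IsDiregular {V : Type*} (A : V → V → Prop) (d : ℕ) : Prop :=
  ∀ u : V, (Nout A u).ncard = d ∧ (Nin A u).ncard = d

/-- The Moore bound `M(d,k) = 1 + d + d² + ⋯ + d^k`. -/
def moore (d k : ℕ) : ℕ := ∑ i ∈ Finset.range (k + 1), d ^ i

/-- `HasWalk A l u v` says that some directed walk of length `l` leads from `u` to `v`. -/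
def HasWalk {V : Type*} (A : V → V → Prop) : ℕ → V → V → Prop
  | 0, u, v => u = v
  | l + 1, u, v => ∃ a, A u a ∧ HasWalk A l a v

/-- `v` is an outlier of `u`: no walk of length at most `k` leads from `u` to `v`. -/
def IsOutlier {V : Type*} (A : V → V → Prop) (k : ℕ) (u v : V) : Prop :=
  ∀ l ≤ k, ¬ HasWalk A l u v

/-- The diregular `k`-geodetic digraphs of degree two and excess `ε`, for the pairs `(k, ε)`
that are excluded below. Geodecity is recorded by the uniqueness of the length and of the
first arc of a short walk. -/
structure SmallExcess {V : Type*} (A : V → V → Prop) (k ε : ℕ) : Prop where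
  out : ∀ u, ∃ a b, a ≠ b ∧ ∀ x, A u x ↔ x = a ∨ x = b
  inn : ∀ v, ∃ a b, a ≠ b ∧ ∀ x, A x v ↔ x = a ∨ x = b
  len : ∀ {u x : V} {l m : ℕ}, HasWalk A l u x → HasWalk A m u x → l ≤ k → m ≤ k → l = m
  first : ∀ {u a b x : V} {l m : ℕ}, A u a → A u b → HasWalk A l a x → HasWalk A m b x →
    l + 1 ≤ k → m + 1 ≤ k → a = b
  card : Nat.card V + 1 = 2 ^ (k + 1) + ε
  small : (ε = 2 ∧ 3 ≤ k) ∨ (ε = 3 ∧ 4 ≤ k)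

/-- `u` and `v` have exactly one common out-neighbour `w`; their other out-neighbours are `u₁`
and `v₁` respectively. -/
structure SharesOne {V : Type*} (A : V → V → Prop) (u v u₁ v₁ w : V) : Prop where
  uu : A u u₁
  uw : A u w
  vv : A v v₁
  vw : A v w
  hu : u₁ ≠ w
  hv : v₁ ≠ w
  hne : u₁ ≠ v₁

section Walks

variable {V : Type*} {A : V → V → Prop}

theorem HasWalk.refl (u : V) : HasWalk A 0 u u := rfl

theorem HasWalk.cons {u a x : V} {l : ℕ} (h : A u a) (h' : HasWalk A l a x) :
    HasWalk A (l + 1) u x := ⟨a, h, h'⟩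

theorem HasWalk.single {u a : V} (h : A u a) : HasWalk A 1 u a := ⟨a, h, rfl⟩

theorem HasWalk.adj {u a : V} (h : HasWalk A 1 u a) : A u a := by
  obtain ⟨b, hb, rfl⟩ := h
  exact hb

theorem HasWalk.trans {l m : ℕ} {u x y : V} (h : HasWalk A l u x) (h' : HasWalk A m x y) :
    HasWalk A (l + m) u y := by
  induction l generalizing u with
  | zero => cases h; simpa using h'
  | succ l ih =>
    obtain ⟨a, ha, h⟩ := h
    rw [Nat.add_right_comm]
    exact ⟨a, ha, ih h⟩

theorem HasWalk.snoc {l : ℕ} {u x y : V} (h : HasWalk A l u x) (h' : A x y) :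
    HasWalk A (l + 1) u y := h.trans (.single h')

theorem HasWalk.cast {l m : ℕ} {u x : V} (h : HasWalk A l u x) (e : l = m) : HasWalk A m u x :=
  e ▸ h

theorem HasWalk.split {l m : ℕ} {u y : V} (h : HasWalk A (l + m) u y) :
    ∃ x, HasWalk A l u x ∧ HasWalk A m x y := by
  induction l generalizing u with
  | zero => exact ⟨u, rfl, by simpa using h⟩
  | succ l ih =>
    rw [Nat.add_right_comm] at h
    obtain ⟨a, ha, h⟩ := h
    obtain ⟨x, h1, h2⟩ := ih h
    exact ⟨x, ⟨a, ha, h1⟩, h2⟩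

theorem SharesOne.symm {u v u₁ v₁ w : V} (p : SharesOne A u v u₁ v₁ w) :
    SharesOne A v u v₁ u₁ w :=
  ⟨p.vv, p.vw, p.uu, p.uw, p.hv, p.hu, p.hne.symm⟩

end Walks

namespace SmallExcess

variable {V : Type*} {A : V → V → Prop} {k ε : ℕ}

section Basic

theorem three_le (h : SmallExcess A k ε) : 3 ≤ k := by
  have := h.small
  omega

theorem finite (h : SmallExcess A k ε) : Finite V := by
  have h1 := h.card
  have h2 := h.small
  have h3 : k + 1 < 2 ^ (k + 1) := Nat.lt_two_pow_self
  exact (Nat.card_pos_iff.1 (by omega)).2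

theorem no_cycle (h : SmallExcess A k ε) {u : V} {l : ℕ} (hw : HasWalk A l u u) (h1 : 1 ≤ l)
    (h2 : l ≤ k) : False := by
  have := h.len hw (.refl u) h2 (Nat.zero_le k)
  omega

theorem eq_or_eq (h : SmallExcess A k ε) {u a b x : V} (ha : A u a) (hb : A u b) (hab : a ≠ b)
    (hx : A u x) : x = a ∨ x = b := by
  obtain ⟨c, d, -, H⟩ := h.out u
  have h1 := (H a).1 ha
  have h2 := (H b).1 hb
  have h3 := (H x).1 hx
  grind

theorem eq_or_eq_in (h : SmallExcess A k ε) {u a b x : V} (ha : A a u) (hb : A b u)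
    (hab : a ≠ b) (hx : A x u) : x = a ∨ x = b := by
  obtain ⟨c, d, -, H⟩ := h.inn u
  have h1 := (H a).1 ha
  have h2 := (H b).1 hb
  have h3 := (H x).1 hx
  grind

theorem exists_out (h : SmallExcess A k ε) (u : V) : ∃ a, A u a := by
  obtain ⟨a, b, -, H⟩ := h.out u
  exact ⟨a, (H a).2 (.inl rfl)⟩

theorem exists_in (h : SmallExcess A k ε) (v : V) : ∃ a, A a v := by
  obtain ⟨a, b, -, H⟩ := h.inn v
  exact ⟨a, (H a).2 (.inl rfl)⟩

theorem exists_other (h : SmallExcess A k ε) {u a : V} (ha : A u a) : ∃ b, A u b ∧ b ≠ a := by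
  obtain ⟨c, d, hcd, H⟩ := h.out u
  rcases (H a).1 ha with rfl | rfl
  · exact ⟨d, (H d).2 (.inr rfl), hcd.symm⟩
  · exact ⟨c, (H c).2 (.inl rfl), hcd⟩

theorem exists_other_in (h : SmallExcess A k ε) {u a : V} (ha : A a u) :
    ∃ b, A b u ∧ b ≠ a := by
  obtain ⟨c, d, hcd, H⟩ := h.inn u
  rcases (H a).1 ha with rfl | rfl
  · exact ⟨d, (H d).2 (.inr rfl), hcd.symm⟩
  · exact ⟨c, (H c).2 (.inl rfl), hcd⟩

theorem ncard_level (h : SmallExcess A k ε) {l : ℕ} (hl : l ≤ k) (u : V) :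
    {x | HasWalk A l u x}.ncard = 2 ^ l := by
  have := h.finite
  induction l generalizing u with
  | zero =>
    have : {x | HasWalk A 0 u x} = {u} := by
      ext x
      exact eq_comm
    simp [this]
  | succ l ih =>
    obtain ⟨a, b, hab, H⟩ := h.out u
    have : {x | HasWalk A (l + 1) u x} = {x | HasWalk A l a x} ∪ {x | HasWalk A l b x} := by
      ext x
      simp [HasWalk, H, or_and_right, exists_or]
    rw [this, Set.ncard_union_eq, ih (by omega), ih (by omega)]
    · ring
    · rw [Set.disjoint_left]
      intro x hx hx'
      exact hab (h.first ((H a).2 (.inl rfl)) ((H b).2 (.inr rfl)) hx hx' hl hl)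

theorem ncard_ball (h : SmallExcess A k ε) {m : ℕ} (hm : m ≤ k) (u : V) :
    {x | ∃ l ≤ m, HasWalk A l u x}.ncard + 1 = 2 ^ (m + 1) := by
  have := h.finite
  induction m with
  | zero =>
    have : {x | ∃ l ≤ 0, HasWalk A l u x} = {x | HasWalk A 0 u x} := by
      ext x
      simp
    rw [this, h.ncard_level hm]
    norm_num
  | succ m ih =>
    have : {x | ∃ l ≤ m + 1, HasWalk A l u x} =
        {x | ∃ l ≤ m, HasWalk A l u x} ∪ {x | HasWalk A (m + 1) u x} := by
      ext x
      simp only [Set.mem_ofPred_eq, Set.mem_union]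
      constructor
      · rintro ⟨l, hl, hx⟩
        rcases Nat.lt_or_ge m l with h1 | h1
        · obtain rfl : l = m + 1 := by omega
          exact .inr hx
        · exact .inl ⟨l, h1, hx⟩
      · rintro (⟨l, hl, hx⟩ | hx)
        · exact ⟨l, by omega, hx⟩
        · exact ⟨_, le_rfl, hx⟩
    rw [this, Set.ncard_union_eq, h.ncard_level hm]
    · have := ih (by omega)
      rw [pow_succ 2 (m + 1)]
      omega
    · rw [Set.disjoint_left]
      rintro x ⟨l, hl, hx⟩ hx'
      have := h.len hx hx' (by omega) hm
      omega

theorem ncard_outliers (h : SmallExcess A k ε) (u : V) : {x | IsOutlier A k u x}.ncard = ε := by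
  have := h.finite
  have h1 := Set.ncard_add_ncard_compl {x | ∃ l ≤ k, HasWalk A l u x}
  have h2 : {x | ∃ l ≤ k, HasWalk A l u x}ᶜ = {x | IsOutlier A k u x} := by
    ext x
    simp [IsOutlier]
  have h3 := h.ncard_ball le_rfl u
  have h4 := h.card
  rw [h2] at h1
  omega

theorem card_le_of_outliers (h : SmallExcess A k ε) {u : V} (F : Finset V)
    (hF : ∀ x ∈ F, IsOutlier A k u x) : F.card ≤ ε := by
  have := h.finite
  rw [← h.ncard_outliers u, ← Set.ncard_coe_finset]
  exact Set.ncard_le_ncard (fun x hx => hF x hx)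

theorem not_four_outliers (h : SmallExcess A k ε) {u a b c d : V} (ha : IsOutlier A k u a)
    (hb : IsOutlier A k u b) (hc : IsOutlier A k u c) (hd : IsOutlier A k u d) (hab : a ≠ b)
    (hac : a ≠ c) (had : a ≠ d) (hbc : b ≠ c) (hbd : b ≠ d) (hcd : c ≠ d) : False := by
  classical
  have h1 := h.card_le_of_outliers (u := u) {a, b, c, d} (by simp [ha, hb, hc, hd])
  have h2 : ({a, b, c, d} : Finset V).card = 4 := by
    rw [Finset.card_insert_of_notMem, Finset.card_insert_of_notMem, Finset.card_pair] <;>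
      simp [*]
  have := h.small
  omega

theorem excess_eq_three (h : SmallExcess A k ε) {u a b c : V} (ha : IsOutlier A k u a)
    (hb : IsOutlier A k u b) (hc : IsOutlier A k u c) (hab : a ≠ b) (hac : a ≠ c)
    (hbc : b ≠ c) : ε = 3 ∧ 4 ≤ k := by
  classical
  have h1 := h.card_le_of_outliers (u := u) {a, b, c} (by simp [ha, hb, hc])
  have h2 : ({a, b, c} : Finset V).card = 3 := by
    rw [Finset.card_insert_of_notMem, Finset.card_pair] <;> simp [*]
  have := h.small
  omega

theorem eq_of_three_outliers (h : SmallExcess A k ε) {u a b c x : V} (ha : IsOutlier A k u a)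
    (hb : IsOutlier A k u b) (hc : IsOutlier A k u c) (hab : a ≠ b) (hac : a ≠ c)
    (hbc : b ≠ c) (hx : IsOutlier A k u x) : x = a ∨ x = b ∨ x = c := by
  by_contra! hcon
  exact h.not_four_outliers ha hb hc hx hab hac hcon.1.symm hbc hcon.2.1.symm hcon.2.2.symm

theorem _root_.IsOutlier.ne {u x : V} (hx : IsOutlier A k u x) : x ≠ u := by
  rintro rfl
  exact hx 0 (Nat.zero_le k) rfl

/-- A whole level of a tree consisting of `u` and outliers of `u` has at most four elements. -/
theorem level_subset_outliers (h : SmallExcess A k ε) {u x : V} {i : ℕ} (hi : 1 ≤ i) (hik : i ≤ k)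
    (H : ∀ z, HasWalk A i x z → z = u ∨ IsOutlier A k u z) :
    i = 1 ∨ (i = 2 ∧ ε = 3 ∧ HasWalk A 2 x u ∧ ∀ z, IsOutlier A k u z → HasWalk A 2 x z) := by
  have := h.finite
  have hsub : {z | HasWalk A i x z} ⊆ insert u {z | IsOutlier A k u z} := fun z hz => H z hz
  have hcard : (insert u {z | IsOutlier A k u z}).ncard = ε + 1 := by
    rw [Set.ncard_insert_of_notMem, h.ncard_outliers]
    exact fun hu => hu.ne rfl
  have hle := Set.ncard_le_ncard hsub
  rw [hcard, h.ncard_level hik] at hle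
  have hs := h.small
  rcases Nat.lt_or_ge i 3 with h3 | h3
  · obtain rfl | rfl : i = 1 ∨ i = 2 := by omega
    · exact .inl rfl
    · have he : ε = 3 := by
        norm_num at hle
        omega
      have heq := Set.eq_of_subset_of_ncard_le hsub (by rw [hcard, h.ncard_level hik, he]; norm_num)
      refine .inr ⟨rfl, he, ?_, fun z hz => ?_⟩
      · exact (heq ▸ Set.mem_insert _ _ : u ∈ {z | HasWalk A 2 x z})
      · exact (heq ▸ Set.mem_insert_of_mem _ hz : z ∈ {z | HasWalk A 2 x z})
  · have : 2 ^ 3 ≤ 2 ^ i := Nat.pow_le_pow_right (by norm_num) h3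
    omega

/-- Two levels of equal depth, one of which contains the other, coincide. -/
theorem level_subset (h : SmallExcess A k ε) {x y z : V} {i : ℕ} (hik : i ≤ k)
    (H : ∀ z, HasWalk A i x z → HasWalk A i y z) (hz : HasWalk A i y z) : HasWalk A i x z := by
  have := h.finite
  have heq : {z | HasWalk A i x z} = {z | HasWalk A i y z} :=
    Set.eq_of_subset_of_ncard_le H (by rw [h.ncard_level hik, h.ncard_level hik])
  exact (heq ▸ hz : z ∈ {z | HasWalk A i x z})

end Basic

section Pairs

variable {u v u₁ v₁ w : V}

theorem mem_tree (h : SmallExcess A k ε) (p : SharesOne A u v u₁ v₁ w) {j : ℕ} {x : V}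
    (hx : HasWalk A j v₁ x) (hj : j + 1 ≤ k) :
    x = u ∨ IsOutlier A k u x ∨ ∃ l, l + 1 ≤ k ∧ HasWalk A l u₁ x := by
  by_cases ho : IsOutlier A k u x
  · exact .inr (.inl ho)
  simp only [IsOutlier, not_forall, not_not] at ho
  obtain ⟨l, hl, hw⟩ := ho
  cases l with
  | zero => exact .inl hw.symm
  | succ l =>
    obtain ⟨a, ha, hw⟩ := hw
    rcases h.eq_or_eq p.uu p.uw p.hu ha with rfl | rfl
    · exact .inr (.inr ⟨l, hl, hw⟩)
    · exact (p.hv (h.first p.vv p.vw hx hw hj hl)).elim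

theorem length_eq_of_walk_to_partner (h : SmallExcess A k ε) (p : SharesOne A u v u₁ v₁ w) {j : ℕ}
    (hx : HasWalk A j v₁ u) (hj : j + 1 ≤ k) : j + 1 = k := by
  by_contra hne
  have := h.len ((hx.cons p.vv).snoc p.uw) (.single p.vw) (by omega) (by omega)
  omega

theorem walk_to_partner (h : SmallExcess A k ε) (p : SharesOne A u v u₁ v₁ w)
    (ho : ¬ IsOutlier A k u v) : HasWalk A (k - 1) u₁ v := by
  simp only [IsOutlier, not_forall, not_not] at ho
  obtain ⟨l, hl, hw⟩ := ho
  cases l with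
  | zero =>
    cases hw
    rcases h.eq_or_eq p.uu p.uw p.hu p.vv with e | e
    · exact (p.hne e.symm).elim
    · exact (p.hv e).elim
  | succ l =>
    obtain ⟨a, ha, hw⟩ := hw
    rcases h.eq_or_eq p.uu p.uw p.hu ha with rfl | rfl
    · have := h.length_eq_of_walk_to_partner p.symm hw hl
      exact hw.cast (by omega)
    · exact (h.no_cycle (hw.cons p.vw) (by omega) hl).elim

/-- A vertex that is deeper in the tree of `u₁` than in that of `v₁` lies near the bottom of
the former. -/
theorem deeper (h : SmallExcess A k ε) (p : SharesOne A u v u₁ v₁ w) {j l : ℕ} {x : V}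
    (hj : HasWalk A j v₁ x) (hl : HasWalk A l u₁ x) (hjl : j < l) (hlk : l + 1 ≤ k) :
    (l + 1 = k ∧ ∀ z, A x z → z = u ∨ IsOutlier A k u z) ∨
      (l + 2 = k ∧ ε = 3 ∧ j + 3 = k ∧ ∀ z, IsOutlier A k u z → HasWalk A 2 x z) := by
  have key : ∀ z, HasWalk A (k - l) x z → z = u ∨ IsOutlier A k u z := by
    intro z hz
    rcases h.mem_tree p (hj.trans hz) (by omega) with e | e | ⟨m, hm, e⟩
    · exact .inl e
    · exact .inr e
    · have := h.len e (hl.trans hz) (by omega) (by omega)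
      omega
  rcases h.level_subset_outliers (by omega) (by omega) key with e | ⟨e, he, hu, ho⟩
  · exact .inl ⟨by omega, fun z hz => key z (e ▸ .single hz)⟩
  · have := h.length_eq_of_walk_to_partner p (hj.trans hu) (by omega)
    exact .inr ⟨by omega, he, by omega, ho⟩

theorem isOutlier_or_deep (h : SmallExcess A k ε) (p : SharesOne A u v u₁ v₁ w) :
    IsOutlier A k u v₁ ∨
      (HasWalk A (k - 1) u₁ v₁ ∧ (∀ z, A v₁ z → IsOutlier A k u z) ∧ IsOutlier A k u v) := by
  have hk := h.three_le
  rcases h.mem_tree p (.refl v₁) (by omega) with rfl | e | ⟨l, hl, e⟩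
  · have := h.length_eq_of_walk_to_partner p (.refl _) (by omega)
    omega
  · exact .inl e
  · refine .inr ?_
    have hl0 : 0 < l := by
      rcases Nat.eq_zero_or_pos l with rfl | h0
      · exact (p.hne e).elim
      · exact h0
    rcases h.deeper p (.refl v₁) e hl0 hl with ⟨h1, h2⟩ | ⟨h1, h2, h3, -⟩
    · have e' : HasWalk A (k - 1) u₁ v₁ := e.cast (by omega)
      refine ⟨e', fun z hz => ?_, ?_⟩
      · rcases h2 z hz with rfl | h2
        · have := h.length_eq_of_walk_to_partner p (.single hz) (by omega)
          omega
        · exact h2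
      · by_contra ho
        have := h.len e' ((h.walk_to_partner p ho).snoc p.vv) (by omega) (by omega)
        omega
    · have := h.small
      omega

theorem isOutlier_unshared (h : SmallExcess A k ε) (p : SharesOne A u v u₁ v₁ w) :
    IsOutlier A k u v₁ := by
  rcases h.isOutlier_or_deep p with ho | ⟨hdeep, hch, hv⟩
  · exact ho
  exfalso
  obtain ⟨c, d, hcd, H⟩ := h.out v₁
  have hc : A v₁ c := (H c).2 (.inl rfl)
  have hd : A v₁ d := (H d).2 (.inr rfl)
  have hvx : ∀ {x}, A v₁ x → v ≠ x := by
    rintro x hx rfl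
    exact h.no_cycle (HasWalk.cons hx (.single p.vv)) (by omega) (by have := h.three_le; omega)
  obtain ⟨hε, hk⟩ := h.excess_eq_three hv (hch c hc) (hch d hd) (hvx hc) (hvx hd) hcd
  have hall : ∀ {x}, IsOutlier A k u x → x = v ∨ A v₁ x := by
    intro x hx
    rcases h.eq_of_three_outliers hv (hch c hc) (hch d hd) (hvx hc) (hvx hd) hcd hx with
      rfl | rfl | rfl
    · exact .inl rfl
    · exact .inr hc
    · exact .inr hd
  have hlow : ∀ {x i}, HasWalk A i v₁ x → 2 ≤ i → i + 1 ≤ k → ¬ IsOutlier A k u x := by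
    intro x i hx hi hik ho
    rcases hall ho with rfl | hx'
    · exact h.no_cycle (hx.cons p.vv) (by omega) (by omega)
    · have := h.len hx (.single hx') (by omega) (by omega)
      omega
  have key : ∀ z, HasWalk A 2 v₁ z → HasWalk A 2 u₁ z := by
    intro z hz
    rcases h.mem_tree p hz (by omega) with rfl | ho | ⟨l, hl, e⟩
    · have := h.length_eq_of_walk_to_partner p hz (by omega)
      omega
    · exact (hlow hz le_rfl (by omega) ho).elim
    rcases lt_trichotomy l 2 with hl2 | rfl | hl2
    · rcases h.deeper p.symm e hz hl2 (by omega) with ⟨h1, -⟩ | ⟨h1, -, h3, h4⟩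
      · omega
      · obtain rfl : l = 1 := by omega
        rcases h.isOutlier_or_deep p.symm with hu | ⟨-, hu, -⟩
        · exact (h.no_cycle (e.trans (h4 _ hu)) (by omega) (by omega)).elim
        · exact (hu z e.adj 3 (by omega) (hz.cons p.vv)).elim
    · exact e
    · exfalso
      rcases h.deeper p hz e hl2 hl with ⟨h1, h2⟩ | ⟨h1, -, h3, h4⟩
      · have hu : ∀ x, A z x → x = u := fun x hx =>
          (h2 x hx).resolve_right (hlow (hz.snoc hx) (by omega) (by omega))
        obtain ⟨e, f, hef, He⟩ := h.out z
        exact hef ((hu e ((He e).2 (.inl rfl))).trans (hu f ((He f).2 (.inr rfl))).symm)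
      · have := h.len (hz.trans (h4 c (hch c hc))) (.single hc) (by omega) (by omega)
        omega
  obtain ⟨g, hg, hg'⟩ := (hdeep.cast (by omega : k - 1 = 2 + (k - 3))).split
  have := h.level_subset (by omega) key hg
  exact h.no_cycle (this.trans hg') (by omega) (by omega)

/-- Vertices of the tree of `v₁` above its last level are outliers of `u`, or at the same depth
in the tree of `u₁`, or in the last level of the latter. -/
theorem level_cases (h : SmallExcess A k ε) (p : SharesOne A u v u₁ v₁ w) {j : ℕ} {x : V}
    (hx : HasWalk A j v₁ x) (hj : j + 2 ≤ k) :
    IsOutlier A k u x ∨ HasWalk A j u₁ x ∨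
      (HasWalk A (k - 1) u₁ x ∧ ∀ z, A x z → z = u ∨ IsOutlier A k u z) := by
  rcases h.mem_tree p hx (by omega) with rfl | ho | ⟨l, hl, e⟩
  · have := h.length_eq_of_walk_to_partner p hx (by omega)
    omega
  · exact .inl ho
  rcases lt_trichotomy l j with hlj | rfl | hlj
  · rcases h.deeper p.symm e hx hlj (by omega) with ⟨h1, -⟩ | ⟨h1, -, h3, h4⟩
    · omega
    · exact (h.no_cycle (e.trans (h4 _ (h.isOutlier_unshared p.symm))) (by omega) (by omega)).elim
  · exact .inr (.inl e)
  · rcases h.deeper p hx e hlj hl with ⟨h1, h2⟩ | ⟨h1, -, h3, h4⟩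
    · exact .inr (.inr ⟨e.cast (by omega), h2⟩)
    · exact (h.no_cycle (hx.trans (h4 _ (h.isOutlier_unshared p))) (by omega) (by omega)).elim

end Pairs

section Chains

variable {u v u₁ v₁ w : V}

theorem not_four_near_outliers (h : SmallExcess A k ε) {a b c d : V} (ha : IsOutlier A k u a)
    (hb : b = u ∨ IsOutlier A k u b) (hc : c = u ∨ IsOutlier A k u c)
    (hd : d = u ∨ IsOutlier A k u d) (hab : a ≠ b) (hac : a ≠ c) (had : a ≠ d) (hbc : b ≠ c)
    (hbd : b ≠ d) (hcd : c ≠ d) (hu : 4 ≤ k → b ≠ u ∧ c ≠ u ∧ d ≠ u) : False := by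
  by_cases hk : 4 ≤ k
  · obtain ⟨h1, h2, h3⟩ := hu hk
    exact h.not_four_outliers ha (hb.resolve_left h1) (hc.resolve_left h2) (hd.resolve_left h3)
      hab hac had hbc hbd hcd
  · rcases hb with rfl | hb
    · exact hk (h.excess_eq_three ha (hc.resolve_left hbc.symm) (hd.resolve_left hbd.symm)
        hac had hcd).2
    · rcases hc with rfl | hc
      · exact hk (h.excess_eq_three ha hb (hd.resolve_left hcd.symm) hab had hbd).2
      · exact hk (h.excess_eq_three ha hb hc hab hac hbc).2

theorem not_deep_child (h : SmallExcess A k ε) (p : SharesOne A u v u₁ v₁ w) {c d : V}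
    (hc : A v₁ c) (hd : A v₁ d) (hcd : c ≠ d)
    (hcz : ∀ z, A c z → z = u ∨ IsOutlier A k u z)
    (hdz : IsOutlier A k u d ∨ ∀ z, A d z → z = u ∨ IsOutlier A k u z) : False := by
  have hk := h.three_le
  have hv₁ := h.isOutlier_unshared p
  obtain ⟨e, f, hef, He⟩ := h.out c
  have he : A c e := (He e).2 (.inl rfl)
  have hf : A c f := (He f).2 (.inr rfl)
  have h2u : ∀ {i x}, HasWalk A i v₁ x → i ≤ 2 → 4 ≤ k → x ≠ u := by
    rintro i x hx hi hk rfl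
    have := h.length_eq_of_walk_to_partner p hx (by omega)
    omega
  have hne : ∀ {i x}, HasWalk A i v₁ x → 1 ≤ i → i ≤ 2 → v₁ ≠ x := by
    rintro i x hx hi hi2 rfl
    exact h.no_cycle hx hi (by omega)
  have hwe : HasWalk A 2 v₁ e := HasWalk.cons hc (.single he)
  have hwf : HasWalk A 2 v₁ f := HasWalk.cons hc (.single hf)
  rcases hdz with hdz | hdz
  · have hned : ∀ {x}, HasWalk A 2 v₁ x → x ≠ d := by
      rintro x hx rfl
      have := h.len hx (.single hd) (by omega) (by omega)
      omega
    exact h.not_four_near_outliers hv₁ (hcz e he) (hcz f hf) (.inr hdz)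
      (hne hwe (by omega) le_rfl) (hne hwf (by omega) le_rfl)
      (hne (.single hd) le_rfl (by omega)) hef (hned hwe) (hned hwf)
      fun hk4 => ⟨h2u hwe le_rfl hk4, h2u hwf le_rfl hk4, h2u (.single hd) (by omega) hk4⟩
  · obtain ⟨g, g', -, Hg⟩ := h.out d
    have hg : A d g := (Hg g).2 (.inl rfl)
    have hwg : HasWalk A 2 v₁ g := HasWalk.cons hd (.single hg)
    have hneg : ∀ {x}, A c x → x ≠ g := by
      rintro x hx rfl
      exact hcd (h.first hc hd (.single hx) (.single hg) (by omega) (by omega))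
    exact h.not_four_near_outliers hv₁ (hcz e he) (hcz f hf) (hdz g hg)
      (hne hwe (by omega) le_rfl) (hne hwf (by omega) le_rfl) (hne hwg (by omega) le_rfl)
      hef (hneg he) (hneg hf)
      fun hk4 => ⟨h2u hwe le_rfl hk4, h2u hwf le_rfl hk4, h2u hwg le_rfl hk4⟩

theorem exists_common_out (h : SmallExcess A k ε) (p : SharesOne A u v u₁ v₁ w) :
    ∃ s, A u₁ s ∧ A v₁ s := by
  by_contra! hno
  have hk := h.three_le
  have hv₁ := h.isOutlier_unshared p
  obtain ⟨c, d, hcd, H⟩ := h.out v₁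
  have hc : A v₁ c := (H c).2 (.inl rfl)
  have hd : A v₁ d := (H d).2 (.inr rfl)
  have hlev : ∀ {x}, A v₁ x → IsOutlier A k u x ∨ ∀ z, A x z → z = u ∨ IsOutlier A k u z := by
    intro x hx
    rcases h.level_cases p (.single hx) (by omega) with e | e | e
    · exact .inl e
    · exact (hno x e.adj hx).elim
    · exact .inr e.2
  have hloop : ∀ {x}, A v₁ x → v₁ ≠ x := by
    rintro x hx rfl
    exact h.no_cycle (.single hx) le_rfl (by omega)
  rcases hlev hc with oc | oc
  swap
  · exact h.not_deep_child p hc hd hcd oc (hlev hd)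
  rcases hlev hd with od | od
  swap
  · exact h.not_deep_child p hd hc hcd.symm od (.inl oc)
  obtain ⟨hε, hk⟩ := h.excess_eq_three hv₁ oc od (hloop hc) (hloop hd) hcd
  have hall : ∀ {x}, IsOutlier A k u x → x = v₁ ∨ A v₁ x := by
    intro x hx
    rcases h.eq_of_three_outliers hv₁ oc od (hloop hc) (hloop hd) hcd hx with rfl | rfl | rfl
    · exact .inl rfl
    · exact .inr hc
    · exact .inr hd
  have hlow : ∀ {x i}, HasWalk A i v₁ x → 2 ≤ i → i + 1 ≤ k → ¬ IsOutlier A k u x := by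
    intro x i hx hi hik ho
    rcases hall ho with rfl | hx'
    · exact h.no_cycle hx (by omega) (by omega)
    · have := h.len hx (.single hx') (by omega) (by omega)
      omega
  have hv : ¬ IsOutlier A k u v := by
    intro ho
    rcases hall ho with e | hx'
    · exact h.no_cycle (.single (e ▸ p.vv)) le_rfl (by omega)
    · exact h.no_cycle (HasWalk.cons hx' (.single p.vv)) (by omega) (by omega)
  have key : ∀ z, HasWalk A 2 v₁ z → HasWalk A 2 u₁ z := by
    intro z hz
    rcases h.level_cases p hz (by omega) with ho | e | ⟨-, h2⟩
    · exact (hlow hz le_rfl (by omega) ho).elim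
    · exact e
    · have hu : ∀ x, A z x → x = u := fun x hx =>
        (h2 x hx).resolve_right (hlow (hz.snoc hx) (by omega) (by omega))
      obtain ⟨e, f, hef, He⟩ := h.out z
      exact (hef ((hu e ((He e).2 (.inl rfl))).trans (hu f ((He f).2 (.inr rfl))).symm)).elim
  obtain ⟨g, hg, hg'⟩ := ((h.walk_to_partner p hv).cast (by omega : k - 1 = 2 + (k - 3))).split
  have := h.level_subset (by omega) key hg
  exact h.no_cycle ((this.trans hg').cons p.vv) (by omega) (by omega)

/-- The unshared out-neighbours have the same out-neighbours, or share exactly one. -/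
theorem next (h : SmallExcess A k ε) (p : SharesOne A u v u₁ v₁ w) :
    (∀ x, A u₁ x ↔ A v₁ x) ∨ ∃ u₂ v₂ s, SharesOne A u₁ v₁ u₂ v₂ s := by
  obtain ⟨s, hs, hs'⟩ := h.exists_common_out p
  obtain ⟨u₂, hu, hus⟩ := h.exists_other hs
  obtain ⟨v₂, hv, hvs⟩ := h.exists_other hs'
  by_cases he : u₂ = v₂
  · subst he
    refine .inl fun x => ⟨fun hx => ?_, fun hx => ?_⟩
    · rcases h.eq_or_eq hu hs hus hx with rfl | rfl <;> assumption
    · rcases h.eq_or_eq hv hs' hus hx with rfl | rfl <;> assumption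
  · exact .inr ⟨u₂, v₂, s, hu, hs, hv, hs', hus, hvs, he⟩

theorem walk_unshared (h : SmallExcess A k ε) (q : SharesOne A u v u₁ v₁ w) {j m : ℕ} {x : V}
    (hx : HasWalk A j v₁ x) (hj : j + 1 ≤ k) (hm : HasWalk A (m + 1) u x) (hmk : m + 1 ≤ k) :
    HasWalk A m u₁ x := by
  obtain ⟨a, ha, hw⟩ := hm
  rcases h.eq_or_eq q.uu q.uw q.hu ha with rfl | rfl
  · exact hw
  · exact (q.hv (h.first q.vv q.vw hx hw hj hmk)).elim

theorem walk_unshared_of_cycle (h : SmallExcess A k ε) (q : SharesOne A u v u₁ v₁ w) {c m : ℕ}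
    {x : V} (hx : HasWalk A c x v) (hm : HasWalk A (m + 1) u x) (hmk : c + 1 + m ≤ k) :
    HasWalk A m u₁ x := by
  obtain ⟨a, ha, hw⟩ := hm
  rcases h.eq_or_eq q.uu q.uw q.hu ha with rfl | rfl
  · exact hw
  · exact (h.no_cycle ((hx.snoc q.vw).trans hw) (by omega) hmk).elim

theorem not_walk_of_same_out (h : SmallExcess A k ε) (H : ∀ x, A u x ↔ A v x) {c m : ℕ} {x : V}
    (hx : HasWalk A c x v) (hm : HasWalk A (m + 1) u x) (hmk : c + 1 + m ≤ k) : False := by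
  obtain ⟨a, ha, hw⟩ := hm
  exact h.no_cycle ((hx.snoc ((H a).1 ha)).trans hw) (by omega) hmk

variable {u₂ v₂ u₃ v₃ u₄ v₄ s t y : V}

theorem isOutlier_second (h : SmallExcess A k ε) (p : SharesOne A u v u₁ v₁ w)
    (q : SharesOne A u₁ v₁ u₂ v₂ s) : IsOutlier A k u v₂ := by
  have hk := h.three_le
  rcases h.level_cases p (.single q.vv) (by omega) with e | e | ⟨e, -⟩
  · exact e
  · exact (q.hne (h.walk_unshared q (.refl v₂) (by omega) e (by omega))).elim
  · exact (h.isOutlier_unshared q _ (by omega) e).elim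

theorem isOutlier_third (h : SmallExcess A k ε) (p : SharesOne A u v u₁ v₁ w)
    (q : SharesOne A u₁ v₁ u₂ v₂ s) (r : SharesOne A u₂ v₂ u₃ v₃ t) (hk : 4 ≤ k) :
    IsOutlier A k u v₃ := by
  rcases h.level_cases p (HasWalk.cons q.vv (.single r.vv)) (by omega) with e | e | ⟨e, -⟩
  · exact e
  · have e := h.walk_unshared q (.single r.vv) (by omega) e (by omega)
    exact (r.hne (h.walk_unshared r (.refl v₃) (by omega) e (by omega))).elim
  · have e := h.walk_unshared q (m := k - 2) (.single r.vv) (by omega) (e.cast (by omega))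
      (by omega)
    exact (h.isOutlier_unshared r _ (by omega) e).elim

theorem isOutlier_fourth (h : SmallExcess A k ε) (p : SharesOne A u v u₁ v₁ w)
    (q : SharesOne A u₁ v₁ u₂ v₂ s) (r : SharesOne A u₂ v₂ u₃ v₃ t)
    (o : SharesOne A u₃ v₃ u₄ v₄ y) (hk : 5 ≤ k) : IsOutlier A k u v₄ := by
  have h4 : HasWalk A 2 v₂ v₄ := HasWalk.cons r.vv (.single o.vv)
  rcases h.level_cases p (h4.cons q.vv) (by omega) with e | e | ⟨e, -⟩
  · exact e
  · have e := h.walk_unshared q h4 (by omega) e (by omega)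
    have e := h.walk_unshared r (.single o.vv) (by omega) e (by omega)
    exact (o.hne (h.walk_unshared o (.refl v₄) (by omega) e (by omega))).elim
  · have e := h.walk_unshared q (m := k - 2) h4 (by omega) (e.cast (by omega)) (by omega)
    have e := h.walk_unshared r (m := k - 3) (.single o.vv) (by omega) (e.cast (by omega))
      (by omega)
    exact (h.isOutlier_unshared o _ (by omega) e).elim

end Chains

/-- The outliers of `u` lie on a single path of length `k - 1` from `v₁` to `u`, and those of
`u₁` on the remainder of this path. -/
structure OutliersOnPath (A : V → V → Prop) (k : ℕ) (u u₁ v₁ : V) : Prop where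
  walk : HasWalk A (k - 1) v₁ u
  out : ∀ z, IsOutlier A k u z → ∃ i, 1 ≤ i ∧ i + 1 ≤ k ∧ HasWalk A i z u ∧ (i + 1 = k → z = v₁)
  self : IsOutlier A k u₁ u
  out₁ : ∀ z, IsOutlier A k u₁ z → ∃ i, i + 2 ≤ k ∧ HasWalk A i z u

section Final

variable {u v u₁ v₁ w u₂ v₂ u₃ v₃ s t : V}

theorem outliersOnPath (h : SmallExcess A k ε) (p : SharesOne A u v u₁ v₁ w)
    (q : SharesOne A u₁ v₁ u₂ v₂ s) (r : SharesOne A u₂ v₂ u₃ v₃ t) :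
    OutliersOnPath A k u u₁ v₁ := by
  have hk := h.three_le
  have ne_of_walk : ∀ {i x y}, HasWalk A i x y → 1 ≤ i → i ≤ 3 → x ≠ y := by
    rintro i x y hx hi hi3 rfl
    exact h.no_cycle hx hi (by omega)
  have hu₂ : HasWalk A 2 u u₂ := HasWalk.cons p.uu (.single q.uu)
  have hu₃ : HasWalk A 3 u u₃ := hu₂.snoc r.uu
  have o₁ := h.isOutlier_unshared p
  have o₂ := h.isOutlier_second p q
  have o₁' := h.isOutlier_unshared p.symm
  have o₂' := h.isOutlier_second p.symm q.symm
  have n₁₂ := ne_of_walk (.single q.vv) le_rfl (by omega)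
  have m₁₂ := ne_of_walk (.single q.uu) le_rfl (by omega)
  have m₀₁ := ne_of_walk (.single p.uu) le_rfl (by omega)
  have m₀₂ := ne_of_walk hu₂ (by omega) (by omega)
  obtain hk3 | hk4 : k = 3 ∨ 4 ≤ k := by omega
  · have hno : ¬ IsOutlier A k v u := fun ho => by
      have := h.excess_eq_three ho o₁' o₂' m₀₁ m₀₂ m₁₂
      omega
    have hw := h.walk_to_partner p.symm hno
    have hw₂ := h.walk_unshared_of_cycle q.symm (m := k - 2) (.single p.uu)
      (hw.cast (by omega)) (by omega)
    have hw₃ := h.walk_unshared_of_cycle r.symm (m := 0) hu₂ (hw₂.cast (by omega)) (by omega)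
    obtain rfl : v₃ = u := hw₃
    refine ⟨hw, fun z hz => ?_, h.isOutlier_second q r, fun z hz => ?_⟩
    · by_cases e₁ : z = v₁
      · subst e₁
        exact ⟨k - 1, by omega, by omega, hw, fun _ => rfl⟩
      by_cases e₂ : z = v₂
      · subst e₂
        exact ⟨1, le_rfl, by omega, .single r.vv, by omega⟩
      have := h.excess_eq_three hz o₁ o₂ e₁ e₂ n₁₂
      omega
    · by_cases e₁ : z = v₂
      · subst e₁
        exact ⟨1, by omega, .single r.vv⟩
      by_cases e₂ : z = v₃
      · subst e₂
        exact ⟨0, by omega, .refl _⟩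
      have := h.excess_eq_three hz (h.isOutlier_unshared q) (h.isOutlier_second q r) e₁ e₂
        (ne_of_walk (.single r.vv) le_rfl (by omega))
      omega
  · have o₃ := h.isOutlier_third p q r hk4
    have o₃' := h.isOutlier_third p.symm q.symm r.symm hk4
    have n₂₃ := ne_of_walk (.single r.vv) le_rfl (by omega)
    have n₁₃ := ne_of_walk (HasWalk.cons q.vv (.single r.vv)) (by omega) (by omega)
    have m₂₃ := ne_of_walk (.single r.uu) le_rfl (by omega)
    have m₁₃ := ne_of_walk (HasWalk.cons q.uu (.single r.uu)) (by omega) (by omega)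
    have m₀₃ := ne_of_walk hu₃ (by omega) (by omega)
    have hno : ¬ IsOutlier A k v u := fun ho =>
      h.not_four_outliers ho o₁' o₂' o₃' m₀₁ m₀₂ m₀₃ m₁₂ m₁₃ m₂₃
    have hw := h.walk_to_partner p.symm hno
    have hw₂ := h.walk_unshared_of_cycle q.symm (m := k - 2) (.single p.uu)
      (hw.cast (by omega)) (by omega)
    have hw₃ := h.walk_unshared_of_cycle r.symm (m := k - 3) hu₂ (hw₂.cast (by omega)) (by omega)
    rcases h.next r with e | ⟨u₄, v₄, y, o⟩
    · exact (h.not_walk_of_same_out (fun x => (e x).symm) (m := k - 4) hu₃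
        (hw₃.cast (by omega)) (by omega)).elim
    obtain hk4 | hk5 : k = 4 ∨ 5 ≤ k := by omega
    · have hw₄ := h.walk_unshared_of_cycle o.symm (m := 0) hu₃ (hw₃.cast (by omega)) (by omega)
      obtain rfl : v₄ = u := hw₄
      refine ⟨hw, fun z hz => ?_, h.isOutlier_third q r o (by omega), fun z hz => ?_⟩
      · rcases h.eq_of_three_outliers o₁ o₂ o₃ n₁₂ n₁₃ n₂₃ hz with rfl | rfl | rfl
        · exact ⟨k - 1, by omega, by omega, hw, fun _ => rfl⟩
        · exact ⟨2, by omega, by omega, HasWalk.cons r.vv (.single o.vv), by omega⟩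
        · exact ⟨1, le_rfl, by omega, .single o.vv, by omega⟩
      · rcases h.eq_of_three_outliers (h.isOutlier_unshared q) (h.isOutlier_second q r)
          (h.isOutlier_third q r o (by omega)) n₂₃
          (ne_of_walk (HasWalk.cons r.vv (.single o.vv)) (by omega) (by omega))
          (ne_of_walk (.single o.vv) le_rfl (by omega)) hz with rfl | rfl | rfl
        · exact ⟨2, by omega, HasWalk.cons r.vv (.single o.vv)⟩
        · exact ⟨1, by omega, .single o.vv⟩
        · exact ⟨0, by omega, .refl _⟩
    · exact (h.not_four_outliers o₁ o₂ o₃ (h.isOutlier_fourth p q r o hk5) n₁₂ n₁₃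
        (ne_of_walk ((HasWalk.single o.vv).cons r.vv |>.cons q.vv) (by omega) (by omega)) n₂₃
        (ne_of_walk (HasWalk.cons r.vv (.single o.vv)) (by omega) (by omega))
        (ne_of_walk (.single o.vv) le_rfl (by omega))).elim

theorem dichotomy (h : SmallExcess A k ε) (p : SharesOne A u v u₁ v₁ w) :
    (IsOutlier A k u v ∧ IsOutlier A k v u ∧ ((∀ x, A u₁ x ↔ A v₁ x) ∨
      ∃ u₂ v₂, A u₁ u₂ ∧ A v₁ v₂ ∧ IsOutlier A k u v₂ ∧ IsOutlier A k v u₂)) ∨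
    (OutliersOnPath A k u u₁ v₁ ∧ OutliersOnPath A k v v₁ u₁) := by
  have hk := h.three_le
  have first_case : ∀ {u v u₁ v₁ w}, SharesOne A u v u₁ v₁ w → (∀ x, A u₁ x ↔ A v₁ x) →
      IsOutlier A k u v := by
    intro u v u₁ v₁ w p e
    by_contra ho
    exact h.not_walk_of_same_out e (m := k - 2) (.single p.vv)
      ((h.walk_to_partner p ho).cast (by omega)) (by omega)
  have second_case : ∀ {u v u₁ v₁ w u₂ v₂ s}, SharesOne A u v u₁ v₁ w →
      SharesOne A u₁ v₁ u₂ v₂ s → (∀ x, A u₂ x ↔ A v₂ x) → IsOutlier A k u v := by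
    intro u v u₁ v₁ w u₂ v₂ s p q e
    by_contra ho
    have := h.walk_unshared_of_cycle q (m := k - 2) (.single p.vv)
      ((h.walk_to_partner p ho).cast (by omega)) (by omega)
    exact h.not_walk_of_same_out e (m := k - 3) (HasWalk.cons p.vv (.single q.vv))
      (this.cast (by omega)) (by omega)
  rcases h.next p with e | ⟨u₂, v₂, s, q⟩
  · exact .inl ⟨first_case p e, first_case p.symm fun x => (e x).symm, .inl e⟩
  rcases h.next q with e | ⟨u₃, v₃, t, r⟩
  · exact .inl ⟨second_case p q e, second_case p.symm q.symm fun x => (e x).symm,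
      .inr ⟨u₂, v₂, q.uu, q.vv, h.isOutlier_second p q, h.isOutlier_second p.symm q.symm⟩⟩
  · exact .inr ⟨h.outliersOnPath p q r, h.outliersOnPath p.symm q.symm r.symm⟩

theorem OutliersOnPath.false_of_isOutlier (h : SmallExcess A k ε)
    (H : OutliersOnPath A k u u₁ v₁) {x y : V} (hu : A u y) (hx : A x y)
    (ho : IsOutlier A k u x) : False := by
  obtain ⟨i, h1, h2, hw, -⟩ := H.out x ho
  have := h.len (hw.snoc hu) (.single hx) (by omega) (by omega)
  omega

theorem not_sharesOne (h : SmallExcess A k ε) (p : SharesOne A u v u₁ v₁ w) : False := by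
  have hk := h.three_le
  obtain ⟨x, hx, hxv⟩ := h.exists_other_in p.vv
  obtain ⟨d, hd, hdv⟩ := h.exists_other hx
  have huv : u ≠ v := by
    rintro rfl
    rcases h.eq_or_eq p.uu p.uw p.hu p.vv with e | e
    · exact p.hne e.symm
    · exact p.hv e
  have hux : u ≠ x := by
    rintro rfl
    rcases h.eq_or_eq p.uu p.uw p.hu hx with e | e
    · exact p.hne e.symm
    · exact p.hv e
  have hdw : d ≠ w := by
    rintro rfl
    rcases h.eq_or_eq_in p.uw p.vw huv hd with e | e
    · exact hux e.symm
    · exact hxv e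
  have q : SharesOne A v x w d v₁ := ⟨p.vw, p.vv, hd, hx, p.hv.symm, hdv, hdw.symm⟩
  have loop : ∀ {y z : V} {i}, A y z → HasWalk A i z y → i + 1 ≤ k → False :=
    fun hy hz hi => h.no_cycle (hz.cons hy) (by omega) hi
  have chord : ∀ {y z t : V}, A y z → A z t → A y t → False := by
    intro y z t h1 h2 h3
    have := h.len (HasWalk.cons h1 (.single h2)) (.single h3) (by omega) (by omega)
    omega
  rcases h.dichotomy p with ⟨ho, ho', hs⟩ | ⟨hl, hl'⟩
  · rcases h.dichotomy q with ⟨ko, ko', ks⟩ | ⟨kl, -⟩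
    swap
    · exact OutliersOnPath.false_of_isOutlier h kl p.vw p.uw ho'
    have hdu : d ≠ u := by
      rintro rfl
      obtain ⟨y, hy, hy'⟩ := h.exists_common_out q
      rcases h.eq_or_eq p.uu p.uw p.hu hy' with rfl | rfl
      · exact chord p.uw hy p.uu
      · exact loop hy (.refl _) (by omega)
    have hu₁x : u₁ ≠ x := by
      rintro rfl
      obtain ⟨y, hy, hy'⟩ := h.exists_common_out p
      rcases h.eq_or_eq hd hx hdv hy with rfl | rfl
      · exact chord hx hy' hd
      · exact loop hy' (.refl _) (by omega)
    have o₁ := h.isOutlier_unshared p.symm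
    have o₂ := h.isOutlier_unshared q
    have huu₁ : u ≠ u₁ := by
      rintro rfl
      exact loop p.uu (.refl _) (by omega)
    have hdx : d ≠ x := by
      rintro rfl
      exact loop hd (.refl _) (by omega)
    obtain rfl : d = u₁ := by
      by_contra hne
      exact h.not_four_outliers ho' o₁ ko o₂ huu₁ hux hdu.symm hu₁x (Ne.symm hne) hdx.symm
    have hall : ∀ y, A d y → ¬ IsOutlier A k v y := by
      intro y hy hoy
      rcases h.eq_of_three_outliers ho' o₁ ko huu₁ hux hdx hoy with rfl | rfl | rfl
      · exact loop hy (.single p.uu) (by omega)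
      · exact loop hy (.refl _) (by omega)
      · exact loop hy (.single hd) (by omega)
    rcases hs with hs | ⟨u₂, -, hu₂, -, -, ou₂⟩
    swap
    · exact hall _ hu₂ ou₂
    rcases ks with ks | ⟨-, v₂, -, hv₂, ov₂, -⟩
    swap
    · exact hall _ hv₂ ov₂
    obtain ⟨y, Hy, -⟩ := h.exists_common_out p
    rcases h.eq_or_eq_in Hy ((hs y).1 Hy) p.hne ((ks y).2 Hy) with e | e
    · exact hdw e.symm
    · exact p.hv e.symm
  · rcases h.dichotomy q with ⟨ko, ko', ks⟩ | ⟨kl, kl'⟩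
    · exact OutliersOnPath.false_of_isOutlier h hl' p.vv hx ko
    obtain rfl : d = u₁ := by
      obtain ⟨i, h1, h2, hw, hi⟩ := hl'.out d (h.isOutlier_unshared q)
      have := h.len hw kl.walk (by omega) (by omega)
      exact hi (by omega)
    have m : SharesOne A u x w v₁ d := ⟨p.uw, p.uu, hx, hd, p.hu.symm, p.hne.symm, p.hv.symm⟩
    rcases h.dichotomy m with ⟨-, mo, -⟩ | ⟨ml, -⟩
    · exact OutliersOnPath.false_of_isOutlier h kl' hd p.uu mo
    · obtain ⟨i, hi, hw⟩ := ml.out₁ v kl.self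
      have := h.len hw (hl.walk.cons p.vv) (by omega) (by omega)
      omega

end Final

section Quotient

/-- Vertices with the same out-neighbours are identified. -/
def sameOut (A : V → V → Prop) : Setoid V where
  r u v := ∀ x, A u x ↔ A v x
  iseqv := ⟨fun _ _ => Iff.rfl, fun h x => (h x).symm, fun h h' x => (h x).trans (h' x)⟩

/-- The digraph induced on the classes of vertices with the same out-neighbours. -/
def classArc (A : V → V → Prop) (c d : Quotient (sameOut A)) : Prop :=
  ∃ u v, Quotient.mk _ u = c ∧ Quotient.mk _ v = d ∧ A u v

theorem mk_eq_mk {u v : V} :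
    Quotient.mk (sameOut A) u = Quotient.mk (sameOut A) v ↔ ∀ x, A u x ↔ A v x :=
  Quotient.eq

theorem same_out (h : SmallExcess A k ε) {u v w : V} (hu : A u w) (hv : A v w) (x : V) :
    A u x ↔ A v x := by
  obtain ⟨a, ha, haw⟩ := h.exists_other hu
  obtain ⟨b, hb, hbw⟩ := h.exists_other hv
  by_cases hab : a = b
  · subst hab
    constructor <;> intro hx
    · rcases h.eq_or_eq ha hu haw hx with rfl | rfl <;> assumption
    · rcases h.eq_or_eq hb hv haw hx with rfl | rfl <;> assumption
  · exact (h.not_sharesOne ⟨ha, hu, hb, hv, haw, hbw, hab⟩).elim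

theorem eq_of_adj_of_same_out (h : SmallExcess A k ε) {u a b : V} (ha : A u a) (hb : A u b)
    (hab : ∀ x, A a x ↔ A b x) : a = b := by
  have hk := h.three_le
  obtain ⟨s, hs⟩ := h.exists_out a
  exact h.first ha hb (.single hs) (.single ((hab s).1 hs)) (by omega) (by omega)

theorem card_eq_two_mul (h : SmallExcess A k ε) :
    Nat.card V = 2 * Nat.card (Quotient (sameOut A)) := by
  classical
  have := h.finite
  have := Fintype.ofFinite (Quotient (sameOut A))
  have hfib : ∀ c : Quotient (sameOut A), Nat.card {x // Quotient.mk (sameOut A) x = c} = 2 := by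
    intro c
    induction c using Quotient.inductionOn with | _ u => ?_
    obtain ⟨w, hw⟩ := h.exists_out u
    obtain ⟨a, b, hab, H⟩ := h.inn w
    have : {x | Quotient.mk (sameOut A) x = Quotient.mk (sameOut A) u} = {a, b} := by
      ext x
      simp only [Set.mem_ofPred_eq, Set.mem_insert_iff, Set.mem_singleton_iff, ← H x, mk_eq_mk]
      exact ⟨fun hx => (hx w).2 hw, fun hx => h.same_out hx hw⟩
    rw [← Set.ncard_pair hab, ← this]
    rfl
  rw [← Nat.card_congr (Equiv.sigmaFiberEquiv (Quotient.mk (sameOut A))), Nat.card_sigma]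
  simp [hfib, mul_comm]

theorem exists_adj_of_classArc {u : V} {d : Quotient (sameOut A)}
    (hd : classArc A (Quotient.mk _ u) d) : ∃ v, A u v ∧ Quotient.mk _ v = d := by
  obtain ⟨u', v, hu, hv, ha⟩ := hd
  exact ⟨v, (mk_eq_mk.1 hu v).1 ha, hv⟩

theorem exists_walk_of_classArc {l : ℕ} {u : V} {d : Quotient (sameOut A)}
    (hd : HasWalk (classArc A) l (Quotient.mk _ u) d) :
    ∃ v, HasWalk A l u v ∧ Quotient.mk _ v = d := by
  induction l generalizing u with
  | zero => exact ⟨u, rfl, hd⟩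
  | succ l ih =>
    obtain ⟨c, hc, hd⟩ := hd
    obtain ⟨a, ha, rfl⟩ := exists_adj_of_classArc hc
    obtain ⟨v, hv, e⟩ := ih hd
    exact ⟨v, hv.cons ha, e⟩

/-- The digraph of classes of a digraph of excess three has excess two. -/
theorem classArc_smallExcess (h : SmallExcess A (k + 1) 3) : SmallExcess (classArc A) k 2 where
  out c := by
    induction c using Quotient.inductionOn with | _ u => ?_
    obtain ⟨a, b, hab, H⟩ := h.out u
    have ha : A u a := (H a).2 (.inl rfl)
    have hb : A u b := (H b).2 (.inr rfl)
    refine ⟨Quotient.mk _ a, Quotient.mk _ b,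
      fun e => hab (h.eq_of_adj_of_same_out ha hb (mk_eq_mk.1 e)), fun x => ⟨fun hx => ?_, ?_⟩⟩
    · obtain ⟨v, hv, rfl⟩ := exists_adj_of_classArc hx
      rcases (H v).1 hv with rfl | rfl
      · exact .inl rfl
      · exact .inr rfl
    · rintro (rfl | rfl)
      · exact ⟨u, a, rfl, rfl, ha⟩
      · exact ⟨u, b, rfl, rfl, hb⟩
  inn c := by
    induction c using Quotient.inductionOn with | _ v => ?_
    obtain ⟨s, hs⟩ := h.exists_out v
    obtain ⟨v', hv', hne⟩ := h.exists_other_in hs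
    obtain ⟨p, hp⟩ := h.exists_in v
    obtain ⟨p', hp'⟩ := h.exists_in v'
    have hvv := h.same_out hv' hs
    refine ⟨Quotient.mk _ p, Quotient.mk _ p', fun e => hne (h.eq_of_adj_of_same_out
      hp' ((mk_eq_mk.1 e v).1 hp) hvv), fun x => ⟨?_, ?_⟩⟩
    · rintro ⟨y, z, rfl, hz, hyz⟩
      have hzs := (mk_eq_mk.1 hz s).2 hs
      rcases h.eq_or_eq_in hv' hs hne hzs with rfl | rfl
      · exact .inr (mk_eq_mk.2 (h.same_out hyz hp'))
      · exact .inl (mk_eq_mk.2 (h.same_out hyz hp))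
    · rintro (rfl | rfl)
      · exact ⟨p, v, rfl, rfl, hp⟩
      · exact ⟨p', v', rfl, mk_eq_mk.2 hvv, hp'⟩
  len {c d l m} hl hm hlk hmk := by
    induction c using Quotient.inductionOn with | _ u => ?_
    obtain ⟨x, hx, rfl⟩ := exists_walk_of_classArc hl
    obtain ⟨y, hy, e⟩ := exists_walk_of_classArc hm
    obtain ⟨s, hs⟩ := h.exists_out x
    have := h.len (hx.snoc hs) (hy.snoc ((mk_eq_mk.1 e s).2 hs)) (by omega) (by omega)
    omega
  first {c a b d l m} ha hb hl hm hlk hmk := by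
    induction c using Quotient.inductionOn with | _ u => ?_
    obtain ⟨a, ha', rfl⟩ := exists_adj_of_classArc ha
    obtain ⟨b, hb', rfl⟩ := exists_adj_of_classArc hb
    obtain ⟨x, hx, rfl⟩ := exists_walk_of_classArc hl
    obtain ⟨y, hy, e⟩ := exists_walk_of_classArc hm
    obtain ⟨s, hs⟩ := h.exists_out x
    rw [h.first ha' hb' (hx.snoc hs) (hy.snoc ((mk_eq_mk.1 e s).2 hs)) (by omega) (by omega)]
  card := by
    have h1 := h.card
    have h2 := h.card_eq_two_mul
    rw [pow_succ] at h1
    omega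
  small := by
    have := h.small
    omega

theorem false_of_excess_two (h : SmallExcess A k 2) : False := by
  have h1 := h.card
  have h2 := h.card_eq_two_mul
  rw [pow_succ] at h1
  omega

theorem false_of_excess_three (h : SmallExcess A k 3) : False := by
  obtain ⟨k, rfl⟩ : ∃ m, k = m + 1 := ⟨k - 1, by have := h.three_le; omega⟩
  exact h.classArc_smallExcess.false_of_excess_two

end Quotient

end SmallExcess

theorem HasWalk.exists_list {V : Type*} {A : V → V → Prop} {l : ℕ} {u x : V}
    (h : HasWalk A l u x) : ∃ p, IsWalkFrom A u x (u :: p) ∧ p.length = l := by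
  induction l generalizing u with
  | zero =>
    cases h
    exact ⟨[], ⟨List.isChain_singleton _, rfl, rfl⟩, rfl⟩
  | succ l ih =>
    obtain ⟨a, ha, h⟩ := h
    obtain ⟨p, ⟨h1, -, h3⟩, hp⟩ := ih h
    exact ⟨a :: p, ⟨List.isChain_cons_cons.2 ⟨ha, h1⟩, rfl, by simpa using h3⟩, by simp [hp]⟩

theorem IsKGeodetic.length_eq {V : Type*} {A : V → V → Prop} {k : ℕ} (hgeo : IsKGeodetic A k)
    {u x : V} {l m : ℕ} (hl : HasWalk A l u x) (hm : HasWalk A m u x) (hlk : l ≤ k)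
    (hmk : m ≤ k) : l = m := by
  obtain ⟨p, hp, rfl⟩ := hl.exists_list
  obtain ⟨q, hq, rfl⟩ := hm.exists_list
  have := hgeo u x _ _ hp hq (by simpa using hlk) (by simpa using hmk)
  simp_all

theorem IsKGeodetic.first_eq {V : Type*} {A : V → V → Prop} {k : ℕ} (hgeo : IsKGeodetic A k)
    {u a b x : V} {l m : ℕ} (ha : A u a) (hb : A u b) (hl : HasWalk A l a x)
    (hm : HasWalk A m b x) (hlk : l + 1 ≤ k) (hmk : m + 1 ≤ k) : a = b := by
  obtain ⟨p, ⟨hp, -, hp'⟩, rfl⟩ := hl.exists_list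
  obtain ⟨q, ⟨hq, -, hq'⟩, rfl⟩ := hm.exists_list
  have := hgeo u x (u :: a :: p) (u :: b :: q)
    ⟨List.isChain_cons_cons.2 ⟨ha, hp⟩, rfl, by simpa using hp'⟩
    ⟨List.isChain_cons_cons.2 ⟨hb, hq⟩, rfl, by simpa using hq'⟩
    (by simpa using hlk) (by simpa using hmk)
  simp_all

theorem moore_two (k : ℕ) : moore 2 k + 1 = 2 ^ (k + 1) := by
  induction k with
  | zero => simp [moore]
  | succ k ih =>
    rw [moore, Finset.sum_range_succ, ← moore, pow_succ 2 (k + 1)]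
    omega

/-- There are no diregular `(2,k,+3)`-digraphs for `k ≥ 4`. -/
theorem no_diregular_2_k_plus3_of_four_le {V : Type*} [Fintype V] (A : V → V → Prop) (k : ℕ)
    (hk : 4 ≤ k) (hirr : Irreflexive A) (hreg : IsDiregular A 2)
    (hgeo : IsKGeodetic A k) :
    Fintype.card V ≠ moore 2 k + 3 := by
  intro hcard
  have hpair : ∀ S : Set V, S.ncard = 2 → ∃ a b, a ≠ b ∧ ∀ x, x ∈ S ↔ x = a ∨ x = b := by
    intro S hS
    obtain ⟨a, b, hab, rfl⟩ := Set.ncard_eq_two.1 hS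
    exact ⟨a, b, hab, fun x => by simp⟩
  have h : SmallExcess A k 3 :=
    { out := fun u => hpair _ (hreg u).1
      inn := fun u => hpair _ (hreg u).2
      len := hgeo.length_eq
      first := hgeo.first_eq
      card := by
        have := moore_two k
        rw [Nat.card_eq_fintype_card]
        omega
      small := .inr ⟨rfl, hk⟩ }
  exact h.false_of_excess_three
end

section
/- (Neighbourhood Lemma) Let G be a diregular (d,k,+ε)-digraph with d ≥ 2, k ≥ 2 and ε ≥ 1. Then for every vertex u of G the multiset equality O(N^+(u)) = N^+(O(u)) holds; that is, the multiset union of the outlier sets of the out-neighbours of u equals the multiset union of the out-neighbourhoods of the outliers of u. -/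
theorem isWalkFrom_cons {V : Type*} {A : V → V → Prop} {u x v : V} {p : List V}
    (hux : A u x) (hp : IsWalkFrom A x v p) : IsWalkFrom A u v (u :: p) := by
  obtain ⟨hc, hh, hl⟩ := hp
  cases p with
  | nil => simp at hh
  | cons y p =>
    obtain rfl : y = x := by simpa using hh
    exact ⟨List.isChain_cons_cons.2 ⟨hux, hc⟩, rfl, by simpa using hl⟩

theorem mem_nIter_zero {V : Type*} {A : V → V → Prop} {u v : V} :
    v ∈ NIter A 0 u ↔ u = v := by
  constructor
  · rintro ⟨p, ⟨-, hh, hl⟩, hlen⟩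
    obtain ⟨a, rfl⟩ := List.length_eq_one_iff.1 hlen
    simp_all
  · rintro rfl
    exact ⟨[u], ⟨List.isChain_singleton u, rfl, rfl⟩, rfl⟩

theorem mem_nIter_succ {V : Type*} {A : V → V → Prop} {n : ℕ} {u v : V} :
    v ∈ NIter A (n + 1) u ↔ ∃ x, A u x ∧ v ∈ NIter A n x := by
  constructor
  · rintro ⟨p, ⟨hc, hh, hl⟩, hlen⟩
    match p, hlen with
    | y :: x :: p, hlen =>
      obtain rfl : y = u := by simpa using hh
      obtain ⟨hyx, hc'⟩ := List.isChain_cons_cons.1 hc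
      exact ⟨x, hyx, x :: p, ⟨hc', rfl, by simpa using hl⟩, by simpa using hlen⟩
  · rintro ⟨x, hux, p, hp, hlen⟩
    exact ⟨u :: p, isWalkFrom_cons hux hp, by simp [hlen]⟩

/-- In a `k`-geodetic digraph, a walk of positive length at most `k` is determined by its ends,
hence so is its second vertex. -/
theorem IsKGeodetic.eq_of_mem_nIter {V : Type*} {A : V → V → Prop} {k n : ℕ}
    (hgeo : IsKGeodetic A k) (hn : n + 1 ≤ k) {u v x y : V} (hux : A u x) (huy : A u y)
    (hx : v ∈ NIter A n x) (hy : v ∈ NIter A n y) : x = y := by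
  obtain ⟨p, hp, hplen⟩ := hx
  obtain ⟨q, hq, hqlen⟩ := hy
  have h := hgeo u v _ _ (isWalkFrom_cons hux hp) (isWalkFrom_cons huy hq)
    (by simp; omega) (by simp; omega)
  have hpq : p = q := (List.cons.inj h).2
  exact Option.some.inj (hp.2.1.symm.trans (hpq ▸ hq.2.1))

/-- In a `k`-geodetic digraph, all walks of length at most `k` between two vertices have the same
length. -/
theorem IsKGeodetic.length_eq_of_mem_nIter {V : Type*} {A : V → V → Prop} {k m n : ℕ}
    (hgeo : IsKGeodetic A k) (hm : m ≤ k) (hn : n ≤ k) {u v : V}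
    (hum : v ∈ NIter A m u) (hun : v ∈ NIter A n u) : m = n := by
  obtain ⟨p, hp, hplen⟩ := hum
  obtain ⟨q, hq, hqlen⟩ := hun
  have h := hgeo u v p q hp hq (by omega) (by omega)
  subst h
  omega

theorem Finset.sum_ite_one_zero_of_subsingleton {α R : Type*} [NonAssocSemiring R] (s : Finset α)
    (P : α → Prop) [DecidablePred P] [Decidable (∃ a ∈ s, P a)]
    (h : ∀ a ∈ s, ∀ b ∈ s, P a → P b → a = b) :
    ∑ a ∈ s, (if P a then (1 : R) else 0) = if ∃ a ∈ s, P a then 1 else 0 := by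
  split_ifs with hex
  · obtain ⟨a, ha, hPa⟩ := hex
    rw [Finset.sum_eq_single a (fun b hb hba => if_neg fun hPb => hba (h b hb a ha hPb hPa))
      (fun hna => absurd ha hna), if_pos hPa]
  · exact Finset.sum_eq_zero fun a ha => if_neg fun hPa => hex ⟨a, ha, hPa⟩

open Classical in
/-- The `0`-`1` matrix of a relation. -/
noncomputable def relMatrix {V : Type*} (R : V → V → Prop) : Matrix V V ℤ :=
  Matrix.of fun u v => if R u v then 1 else 0

open Classical in
theorem relMatrix_apply {V : Type*} (R : V → V → Prop) (u v : V) :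
    relMatrix R u v = if R u v then 1 else 0 := rfl

theorem relMatrix_mul_apply {V : Type*} [Fintype V] (R S : V → V → Prop) (u w : V) :
    (relMatrix R * relMatrix S) u w = ({x | R u x ∧ S x w} : Set V).ncard := by
  classical
  simp only [Matrix.mul_apply, relMatrix_apply, ← ite_and, mul_ite, mul_one, mul_zero]
  rw [Finset.sum_boole, Set.ncard_eq_toFinset_card']
  simp [and_comm]

theorem IsKGeodetic.relMatrix_pow {V : Type*} [Fintype V] [DecidableEq V]
    {A : V → V → Prop} {k : ℕ}
    (hgeo : IsKGeodetic A k) {n : ℕ} (hn : n ≤ k) :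
    relMatrix A ^ n = relMatrix fun u v => v ∈ NIter A n u := by
  classical
  induction n with
  | zero =>
    ext u v
    simp [relMatrix_apply, Matrix.one_apply, mem_nIter_zero]
  | succ n ih =>
    ext u v
    rw [pow_succ', ih (by omega), Matrix.mul_apply]
    simp only [relMatrix_apply, mem_nIter_succ, mul_ite, mul_one, mul_zero, ← ite_and]
    rw [Finset.sum_ite_one_zero_of_subsingleton]
    · simp [and_comm]
    · rintro x - y - ⟨hx, hux⟩ ⟨hy, huy⟩
      exact hgeo.eq_of_mem_nIter hn hux huy hx hy

theorem IsKGeodetic.sum_relMatrix_pow {V : Type*} [Fintype V] [DecidableEq V]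
    {A : V → V → Prop} {k : ℕ}
    (hgeo : IsKGeodetic A k) :
    ∑ n ∈ Finset.range (k + 1), relMatrix A ^ n = relMatrix fun u v => v ∈ Ball A k u := by
  classical
  rw [Finset.sum_congr rfl fun n hn =>
    hgeo.relMatrix_pow (Nat.lt_succ_iff.1 (Finset.mem_range.1 hn))]
  ext u v
  simp only [Matrix.sum_apply, relMatrix_apply]
  rw [Finset.sum_ite_one_zero_of_subsingleton]
  · simp [Ball]
    congr
  · intro m hm n hn
    exact hgeo.length_eq_of_mem_nIter (Nat.lt_succ_iff.1 (Finset.mem_range.1 hm))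
      (Nat.lt_succ_iff.1 (Finset.mem_range.1 hn))

theorem relMatrix_not {V : Type*} (R : V → V → Prop) :
    relMatrix (fun u v => ¬ R u v) = relMatrix (fun _ _ => True) - relMatrix R := by
  ext u v
  by_cases h : R u v <;> simp [relMatrix_apply, h]

theorem IsDiregular.commute_relMatrix_true {V : Type*} [Fintype V] {A : V → V → Prop} {d : ℕ}
    (hreg : IsDiregular A d) : Commute (relMatrix A) (relMatrix fun _ _ => True) := by
  ext u w
  rw [relMatrix_mul_apply, relMatrix_mul_apply]
  simpa [Nout, Nin] using (hreg u).1.trans (hreg w).2.symm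

theorem commute_relMatrix_outliers {V : Type*} [Fintype V] {A : V → V → Prop} {d k : ℕ}
    (hreg : IsDiregular A d) (hgeo : IsKGeodetic A k) :
    Commute (relMatrix A) (relMatrix fun u v => v ∈ Outliers A k u) := by
  classical
  have h : Commute (relMatrix A) (relMatrix fun u v => v ∈ Ball A k u) := by
    rw [← hgeo.sum_relMatrix_pow]
    exact Commute.sum_right _ _ _ fun n _ => Commute.pow_right (Commute.refl _) n
  have := hreg.commute_relMatrix_true.sub_right h
  rwa [← relMatrix_not] at this

/-- **Neighbourhood Lemma.**  In a diregular `(d,k,+ε)`-digraph with `d ≥ 2`,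
`k ≥ 2` and `ε ≥ 1`, for every vertex `u` the multisets `O(N⁺(u))` and
`N⁺(O(u))` coincide: every vertex `w` occurs in the two multisets with the same
multiplicity, namely the number of out-neighbours `x` of `u` with `w ∈ O(x)`
equals the number of outliers `y` of `u` with `w ∈ N⁺(y)`. -/
theorem neighbourhood_lemma {V : Type*} [Fintype V] (A : V → V → Prop)
    (d k ε : ℕ) (hd : 2 ≤ d) (hk : 2 ≤ k) (hε : 1 ≤ ε)
    (hirr : Irreflexive A) (hreg : IsDiregular A d) (hgeo : IsKGeodetic A k)
    (hcard : Fintype.card V = moore d k + ε) :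
    ∀ u w : V,
      {x : V | x ∈ Nout A u ∧ w ∈ Outliers A k x}.ncard =
        {y : V | y ∈ Outliers A k u ∧ w ∈ Nout A y}.ncard := by
  intro u w
  have h := congrFun (congrFun (commute_relMatrix_outliers hreg hgeo).eq u) w
  rw [relMatrix_mul_apply, relMatrix_mul_apply] at h
  exact_mod_cast h
end

section
/- In a diregular (d,k,+ε)-digraph, every vertex w is an outlier of exactly ε distinct vertices; that is, |{ x : w ∈ O(x) }| = ε. In particular, in a diregular (2,k,+3)-digraph every vertex is an outlier of exactly three distinct vertices. -/
/-- Prepending an arc to a walk gives a walk. -/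
theorem IsWalkFrom.cons {V : Type*} {A : V → V → Prop} {x y w : V} {p : List V}
    (hxy : A x y) (hp : IsWalkFrom A y w p) : IsWalkFrom A x w (x :: p) := by
  obtain ⟨hchain, hhead, hlast⟩ := hp
  cases p with
  | nil => simp at hhead
  | cons a p =>
    obtain rfl : a = y := by simpa using hhead
    exact ⟨List.isChain_cons_cons.2 ⟨hxy, hchain⟩, rfl, by simpa using hlast⟩

theorem mem_NIter_zero {V : Type*} {A : V → V → Prop} {x w : V} :
    w ∈ NIter A 0 x ↔ x = w := by
  constructor
  · rintro ⟨p, ⟨-, hhead, hlast⟩, hlen⟩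
    obtain ⟨a, rfl⟩ := List.length_eq_one_iff.1 hlen
    simp_all
  · rintro rfl
    exact ⟨[x], ⟨List.isChain_singleton x, rfl, rfl⟩, rfl⟩

theorem mem_NIter_succ {V : Type*} {A : V → V → Prop} {m : ℕ} {x w : V} :
    w ∈ NIter A (m + 1) x ↔ ∃ y, A x y ∧ w ∈ NIter A m y := by
  constructor
  · rintro ⟨p, ⟨hchain, hhead, hlast⟩, hlen⟩
    match p, hchain, hhead, hlast, hlen with
    | a :: b :: p, hchain, hhead, hlast, hlen =>
      obtain rfl : a = x := by simpa using hhead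
      obtain ⟨hab, hchain⟩ := List.isChain_cons_cons.1 hchain
      exact ⟨b, hab, b :: p, ⟨hchain, rfl, by simpa using hlast⟩, by simpa using hlen⟩
  · rintro ⟨y, hxy, p, hp, hlen⟩
    exact ⟨x :: p, hp.cons hxy, by simp [hlen]⟩

/-- In a `k`-geodetic digraph with all in-degrees `d`, exactly `d ^ m` vertices reach a given
vertex by a walk of length `m ≤ k`. -/
theorem IsKGeodetic.ncard_setOf_mem_NIter {V : Type*} [Finite V] {A : V → V → Prop} {d k : ℕ}
    (hgeo : IsKGeodetic A k) (hin : ∀ u, (Nin A u).ncard = d) (w : V) {m : ℕ} (hm : m ≤ k) :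
    {x | w ∈ NIter A m x}.ncard = d ^ m := by
  classical
  have := Fintype.ofFinite V
  induction m with
  | zero => simp [mem_NIter_zero]
  | succ m ih =>
    have hset : {x | w ∈ NIter A (m + 1) x} =
        ((({y | w ∈ NIter A m y} : Set V).toFinset.biUnion fun y => (Nin A y).toFinset :
          Finset V) : Set V) := by
      ext x
      simp only [Set.mem_ofPred_eq, mem_NIter_succ, Finset.coe_biUnion, Set.coe_toFinset,
        Set.mem_iUnion, exists_prop]
      exact exists_congr fun y => and_comm
    rw [hset, Set.ncard_coe_finset, Finset.card_biUnion]
    · simp only [← Set.ncard_eq_toFinset_card', hin, Finset.sum_const, smul_eq_mul]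
      rw [ih (by omega), pow_succ]
    · intro y hy z hz hyz
      rw [Finset.mem_coe, Set.mem_toFinset] at hy hz
      obtain ⟨p, hp, hpl⟩ := hy
      obtain ⟨q, hq, hql⟩ := hz
      rw [Function.onFun, Finset.disjoint_left]
      intro x hxy hxz
      rw [Set.mem_toFinset] at hxy hxz
      have hpq := hgeo x w _ _ (hp.cons hxy) (hq.cons hxz) (by simp; omega) (by simp; omega)
      obtain rfl : p = q := List.tail_eq_of_cons_eq hpq
      exact hyz (Option.some.inj (hp.2.1.symm.trans hq.2.1))

/-- In a `k`-geodetic digraph with all in-degrees `d`, exactly `moore d k` vertices have a given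
vertex within distance `k`. -/
theorem IsKGeodetic.ncard_setOf_mem_Ball {V : Type*} [Finite V] {A : V → V → Prop} {d k : ℕ}
    (hgeo : IsKGeodetic A k) (hin : ∀ u, (Nin A u).ncard = d) (w : V) :
    {x | w ∈ Ball A k x}.ncard = moore d k := by
  classical
  have := Fintype.ofFinite V
  have hset : {x | w ∈ Ball A k x} =
      (((Finset.range (k + 1)).biUnion fun m => ({x | w ∈ NIter A m x} : Set V).toFinset :
        Finset V) : Set V) := by
    ext x
    simp [Ball]
  rw [hset, Set.ncard_coe_finset, Finset.card_biUnion, moore]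
  · refine Finset.sum_congr rfl fun m hm => ?_
    rw [← Set.ncard_eq_toFinset_card']
    exact hgeo.ncard_setOf_mem_NIter hin w (by simpa [Nat.lt_succ_iff] using hm)
  · intro m hm n hn hmn
    rw [Finset.mem_coe, Finset.mem_range] at hm hn
    rw [Function.onFun, Finset.disjoint_left]
    intro x hxm hxn
    rw [Set.mem_toFinset] at hxm hxn
    obtain ⟨p, hp, hpl⟩ := hxm
    obtain ⟨q, hq, hql⟩ := hxn
    obtain rfl := hgeo x w p q hp hq (by omega) (by omega)
    omega

/-- In a diregular `(d,k,+ε)`-digraph, every vertex `w` is an outlier of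
exactly `ε` distinct vertices. -/
theorem outlier_of_exactly_eps_vertices {V : Type*} [Fintype V]
    (A : V → V → Prop) (d k ε : ℕ) (hirr : Irreflexive A)
    (hreg : IsDiregular A d) (hgeo : IsKGeodetic A k)
    (hcard : Fintype.card V = moore d k + ε) :
    ∀ w : V, {x : V | w ∈ Outliers A k x}.ncard = ε := by
  intro w
  have hball := hgeo.ncard_setOf_mem_Ball (fun u => (hreg u).2) w
  have hcompl : {x | w ∈ Outliers A k x} = {x | w ∈ Ball A k x}ᶜ := rfl
  have hadd := Set.ncard_add_ncard_compl {x | w ∈ Ball A k x}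
  rw [Nat.card_eq_fintype_card] at hadd
  rw [hcompl]
  omega
end
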